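/- Let n ≥ 3 and let ε ∈ {−1,1}ⁿ be the sign pattern with ε_n = −1 and ε_i = 1 for all i < n. Suppose p_1,…,p_n ≥ 1 satisfy 1/p_{n−1} + 1/p_n < 1. Then C_n^ε is not bounded from L^{p_1} × ⋯ × L^{p_n} into L^{1/(Σ_{i=1}^n 1/p_i)}: for every constant C > 0 there exist Schwartz functions f_1,…,f_n with compactly supported Fourier transforms such that ‖C_n^ε(f_1,…,f_n)‖_{L^{1/(Σ 1/p_i)}(ℝ)} > C ∏_{i=1}^n ‖f_i‖_{L^{p_i}}. -/

import Mathlib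

open MeasureTheory Complex
open scoped FourierTransform Real ENNReal

/-- The multilinear oscillatory integral operator `C_n^ε`. -/
noncomputable def Cop {n : ℕ} (ε : Fin n → ℝ) (f : Fin n → ℝ → ℂ) (x : ℝ) : ℂ :=
  ∫ t in {t : Fin n → ℝ | StrictMono t},
    (∏ i, 𝓕 (f i) (t i)) * Complex.exp (2 * π * Complex.I * x * ∑ i, ε i * t i)

/-- The oscillating factor `r ↦ e^{2πir}`. -/
noncomputable def osc (r : ℝ) : ℂ := Complex.exp (2 * π * Complex.I * r)

lemma osc_add (r s : ℝ) : osc (r + s) = osc r * osc s := by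
  rw [osc, osc, osc, ← Complex.exp_add]; push_cast; ring_nf

lemma osc_zero : osc 0 = 1 := by simp [osc]

lemma norm_osc (r : ℝ) : ‖osc r‖ = 1 := by
  have : osc r = Complex.exp ((2 * π * r : ℝ) * Complex.I) := by
    rw [osc]; push_cast; ring_nf
  rw [this, Complex.norm_exp_ofReal_mul_I]

lemma contDiff_osc : ContDiff ℝ ((⊤ : ℕ∞) : WithTop ℕ∞) osc := by
  unfold osc
  exact (contDiff_const.mul Complex.ofRealCLM.contDiff).cexp

/-- The smooth bump around `1/2` underlying `window`. -/
noncomputable def windowBump : ContDiffBump (1 / 2 : ℝ) :=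
  ⟨1 / 8, 1 / 4, by norm_num, by norm_num⟩

/-- A smooth nonnegative function of integral one supported inside `(0,1)`. -/
noncomputable def window (t : ℝ) : ℝ := windowBump.normed volume t

lemma window_nonneg (t : ℝ) : 0 ≤ window t := windowBump.nonneg_normed t

lemma mem_Ioo_of_window_ne_zero {t : ℝ} (h : window t ≠ 0) : t ∈ Set.Ioo (0 : ℝ) 1 := by
  have : t ∈ Function.support (windowBump.normed volume) := h
  rw [windowBump.support_normed_eq, Metric.mem_ball, Real.dist_eq, abs_lt] at this
  have h2 : windowBump.rOut = 1 / 4 := rfl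
  rw [h2] at this
  constructor <;> linarith [this.1, this.2]

lemma contDiff_window : ContDiff ℝ ((⊤ : ℕ∞) : WithTop ℕ∞) window :=
  windowBump.contDiff_normed

lemma hasCompactSupport_window : HasCompactSupport window :=
  windowBump.hasCompactSupport_normed

lemma integral_window : ∫ t, window t = 1 := windowBump.integral_normed

lemma integral_window_sq_pos : 0 < ∫ t, window t ^ 2 := by
  have hc : Continuous fun t => window t ^ 2 := contDiff_window.continuous.pow 2
  have hs : HasCompactSupport fun t => window t ^ 2 :=
    hasCompactSupport_window.comp_left (g := fun y : ℝ => y ^ 2) (by simp)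
  apply hc.integral_pos_of_hasCompactSupport_nonneg_nonzero hs (fun t => sq_nonneg _) (x := 1 / 2)
  have : (1 / 2 : ℝ) ∈ Function.support (windowBump.normed volume) := by
    rw [windowBump.support_normed_eq]
    exact Metric.mem_ball_self windowBump.rOut_pos
  exact pow_ne_zero 2 this

/-- A modulated and translated window. -/
noncomputable def tile (z l t : ℝ) : ℂ := (window (t - l) : ℂ) * osc (z * t)

lemma contDiff_tile (z l : ℝ) : ContDiff ℝ ((⊤ : ℕ∞) : WithTop ℕ∞) (tile z l) := by
  unfold tile
  refine ContDiff.mul ?_ (contDiff_osc.comp (contDiff_const.mul contDiff_id))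
  exact Complex.ofRealCLM.contDiff.comp (contDiff_window.comp (contDiff_id.sub contDiff_const))

lemma mem_Ioo_of_tile_ne_zero {z l t : ℝ} (h : tile z l t ≠ 0) : t ∈ Set.Ioo l (l + 1) := by
  have : window (t - l) ≠ 0 := by
    intro h0; exact h (by simp [tile, h0])
  have := mem_Ioo_of_window_ne_zero this
  constructor <;> linarith [this.1, this.2]

lemma hasCompactSupport_tile (z l : ℝ) : HasCompactSupport (tile z l) := by
  apply HasCompactSupport.intro (isCompact_Icc (a := l) (b := l + 1))
  intro t ht
  by_contra h
  exact ht (Set.Ioo_subset_Icc_self (mem_Ioo_of_tile_ne_zero h))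

lemma continuous_tile (z l : ℝ) : Continuous (tile z l) := (contDiff_tile z l).continuous

lemma integrable_tile (z l : ℝ) : Integrable (tile z l) :=
  (continuous_tile z l).integrable_of_hasCompactSupport (hasCompactSupport_tile z l)

lemma tile_mul_osc (z l w t : ℝ) : tile z l t * osc (w * t) = tile (z + w) l t := by
  rw [tile, tile, mul_assoc, ← osc_add, add_mul]

lemma tile_add_right (z l t : ℝ) : tile z l (t + l) = osc (z * l) * tile z 0 t := by
  rw [tile, tile, mul_add, osc_add]; simp; ring

lemma norm_tile (z l t : ℝ) : ‖tile z l t‖ = window (t - l) := by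
  rw [tile, norm_mul, norm_osc, mul_one, Complex.norm_real, Real.norm_of_nonneg (window_nonneg _)]

/-- The inverse Fourier transform of `window`. -/
noncomputable def profile (z : ℝ) : ℂ := ∫ t, tile z 0 t

lemma integral_tile (z l : ℝ) : ∫ t, tile z l t = osc (z * l) * profile z := by
  rw [profile, ← integral_const_mul, ← integral_add_right_eq_self _ l]
  exact integral_congr_ae (Filter.Eventually.of_forall fun t => tile_add_right z l t)

lemma norm_integral_tile (z l : ℝ) : ‖∫ t, tile z l t‖ = ‖profile z‖ := by
  rw [integral_tile, norm_mul, norm_osc, one_mul]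

lemma fourierInv_eq_integral_osc (f : ℝ → ℂ) (x : ℝ) : 𝓕⁻ f x = ∫ t, f t * osc (x * t) := by
  rw [Real.fourierInv_eq']
  refine integral_congr_ae (Filter.Eventually.of_forall fun t => ?_)
  simp only [smul_eq_mul, osc]
  rw [mul_comm]
  congr 2
  simp
  ring

/-- `window` as a Schwartz function. -/
noncomputable def windowSchwartz : SchwartzMap ℝ ℂ :=
  (hasCompactSupport_tile 0 0).toSchwartzMap (contDiff_tile 0 0)

lemma profile_eq_fourierInv : profile = ⇑(𝓕⁻ windowSchwartz : SchwartzMap ℝ ℂ) := by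
  ext z
  rw [SchwartzMap.fourierInv_coe, fourierInv_eq_integral_osc]
  simp only [profile]
  refine integral_congr_ae (Filter.Eventually.of_forall fun t => ?_)
  have : windowSchwartz t = tile 0 0 t := rfl
  simp only [this, tile_mul_osc, zero_add]

lemma continuous_profile : Continuous profile := by
  rw [profile_eq_fourierInv]; exact SchwartzMap.continuous _

lemma integrable_profile : Integrable profile := by
  rw [profile_eq_fourierInv]; exact SchwartzMap.integrable _

lemma profile_zero : profile 0 = 1 := by
  have : ∀ t, tile 0 0 t = (window t : ℂ) := by intro t; simp [tile, osc_zero]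
  simp only [profile, this]
  rw [integral_complex_ofReal, integral_window]; simp

lemma exists_profile_decay : ∃ A : ℝ, 0 < A ∧ ∀ z, ‖profile z‖ ≤ A / (1 + |z|) ^ 3 := by
  have h := fun x => SchwartzMap.one_add_le_sup_seminorm_apply (𝕜 := ℝ) (m := (3, 0)) (k := 3)
    (n := 0) le_rfl le_rfl (𝓕⁻ windowSchwartz : SchwartzMap ℝ ℂ) x
  simp only [norm_iteratedFDeriv_zero, ← profile_eq_fourierInv] at h
  set K := 2 ^ 3 * ((Finset.Iic (3, 0)).sup fun m : ℕ × ℕ =>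
    SchwartzMap.seminorm ℝ (E := ℝ) (F := ℂ) m.1 m.2) (𝓕⁻ windowSchwartz : SchwartzMap ℝ ℂ)
  refine ⟨max K 1, by positivity, fun z => ?_⟩
  rw [le_div_iff₀ (by positivity), mul_comm]
  exact (h z).trans (le_max_left _ _)

/-- The correlation of two tiles over the half plane `s < t`. -/
noncomputable def halfCorr (z : ℝ) : ℂ :=
  ∫ q : ℝ × ℝ, {q : ℝ × ℝ | q.1 < q.2}.indicator (fun q => tile z 0 q.1 * tile (-z) 0 q.2) q

lemma measurableSet_halfPlane : MeasurableSet {q : ℝ × ℝ | q.1 < q.2} :=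
  measurableSet_lt measurable_fst measurable_snd

lemma integrable_half_tiles (z w l k : ℝ) :
    Integrable ({q : ℝ × ℝ | q.1 < q.2}.indicator fun q => tile z l q.1 * tile w k q.2) :=
  ((integrable_tile z l).mul_prod (integrable_tile w k)).indicator measurableSet_halfPlane

lemma norm_halfCorr_le (z : ℝ) : ‖halfCorr z‖ ≤ 1 := by
  refine (norm_integral_le_integral_norm _).trans ?_
  have h1 : ∫ q : ℝ × ℝ, window q.1 * window q.2 = 1 := by
    rw [Measure.volume_eq_prod, integral_prod_mul, integral_window, one_mul]
  have hw : Integrable window :=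
    contDiff_window.continuous.integrable_of_hasCompactSupport hasCompactSupport_window
  rw [← h1]
  refine integral_mono (integrable_half_tiles _ _ _ _).norm (hw.mul_prod hw) fun q => ?_
  simp only
  refine (norm_indicator_le_norm_self _ _).trans ?_
  simp [norm_tile]

lemma integral_half_tiles_diag (z l : ℝ) :
    ∫ q : ℝ × ℝ, {q : ℝ × ℝ | q.1 < q.2}.indicator
      (fun q => tile z l q.1 * tile (-z) l q.2) q = halfCorr z := by
  rw [halfCorr, ← integral_add_right_eq_self _ ((l, l) : ℝ × ℝ)]
  refine integral_congr_ae (Filter.Eventually.of_forall fun q => ?_)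
  simp only [Set.indicator_apply, Set.mem_ofPred_eq, Prod.fst_add, Prod.snd_add,
    add_lt_add_iff_right, tile_add_right]
  split_ifs
  · have : osc (z * l) * osc (-z * l) = 1 := by
      rw [← osc_add, ← osc_zero]; ring_nf
    linear_combination (tile z 0 q.1 * tile (-z) 0 q.2) * this
  · rfl

lemma integral_half_tiles_lt {l k : ℝ} (h : l + 1 ≤ k) (z w : ℝ) :
    ∫ q : ℝ × ℝ, {q : ℝ × ℝ | q.1 < q.2}.indicator
      (fun q => tile z l q.1 * tile w k q.2) q = (∫ t, tile z l t) * ∫ t, tile w k t := by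
  rw [← integral_prod_mul, ← Measure.volume_eq_prod]
  refine integral_congr_ae (Filter.Eventually.of_forall fun q => ?_)
  simp only [Set.indicator_apply, Set.mem_ofPred_eq]
  split_ifs with hq
  · rfl
  · by_contra hne
    have h1 := mem_Ioo_of_tile_ne_zero (left_ne_zero_of_mul (Ne.symm hne))
    have h2 := mem_Ioo_of_tile_ne_zero (right_ne_zero_of_mul (Ne.symm hne))
    exact hq (by linarith [h1.2, h2.1])

lemma integral_half_tiles_gt {l k : ℝ} (h : k + 1 ≤ l) (z w : ℝ) :
    ∫ q : ℝ × ℝ, {q : ℝ × ℝ | q.1 < q.2}.indicator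
      (fun q => tile z l q.1 * tile w k q.2) q = 0 := by
  refine (integral_congr_ae (Filter.Eventually.of_forall fun q => ?_)).trans (integral_zero _ _)
  simp only [Set.indicator_apply, Set.mem_ofPred_eq]
  split_ifs with hq
  · by_contra hne
    have h1 := mem_Ioo_of_tile_ne_zero (left_ne_zero_of_mul hne)
    have h2 := mem_Ioo_of_tile_ne_zero (right_ne_zero_of_mul hne)
    linarith [h1.1, h2.2]
  · rfl

lemma hasDerivAt_osc_mul (z s : ℝ) :
    HasDerivAt (fun s : ℝ => osc (z * s)) (2 * π * Complex.I * z * osc (z * s)) s := by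
  unfold osc
  have h : HasDerivAt (fun s : ℝ => 2 * π * Complex.I * ((z * s : ℝ) : ℂ))
      (2 * π * Complex.I * z) s := by
    have h1 : HasDerivAt (fun s : ℝ => ((z * s : ℝ) : ℂ)) (z : ℂ) s := by
      have := ((hasDerivAt_id s).const_mul z).ofReal_comp
      simpa using this
    exact h1.const_mul _
  convert h.cexp using 1
  ring

lemma setIntegral_Iic_mul_osc {g : ℝ → ℝ} (hg : ContDiff ℝ 1 g) (hs : HasCompactSupport g)
    {z : ℝ} (hz : z ≠ 0) (t : ℝ) :
    ∫ s in Set.Iic t, (g s : ℂ) * osc (z * s) =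
      ((g t : ℂ) * osc (z * t) - ∫ s in Set.Iic t, ((deriv g s : ℝ) : ℂ) * osc (z * s)) /
        (2 * π * Complex.I * z) := by
  have hosc : Continuous fun s => osc (z * s) :=
    contDiff_osc.continuous.comp (continuous_const.mul continuous_id)
  have hint : ∀ {h : ℝ → ℝ}, Continuous h → HasCompactSupport h →
      Integrable fun s => (h s : ℂ) * osc (z * s) := fun {h} hc hh =>
    ((Complex.continuous_ofReal.comp hc).mul hosc).integrable_of_hasCompactSupport
      ((hh.comp_left (g := fun y : ℝ => (y : ℂ)) (by simp)).mul_right)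
  have hd : ∀ s, HasDerivAt (fun s => (g s : ℂ) * osc (z * s))
      (((deriv g s : ℝ) : ℂ) * osc (z * s) + (2 * π * Complex.I * z) * ((g s : ℂ) * osc (z * s))) s := by
    intro s
    have h1 := ((hg.differentiable (by norm_num) s).hasDerivAt.ofReal_comp).mul
      (hasDerivAt_osc_mul z s)
    refine h1.congr_deriv ?_
    ring
  have i1 := hint (hg.continuous_deriv le_rfl) hs.deriv
  have i2 := (hint hg.continuous hs).const_mul (2 * π * Complex.I * z)
  have hlim : Filter.Tendsto (fun s => (g s : ℂ) * osc (z * s)) Filter.atBot (nhds 0) := by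
    have hh : HasCompactSupport (fun s => (g s : ℂ) * osc (z * s)) :=
      (hs.comp_left (g := fun y : ℝ => (y : ℂ)) (by simp)).mul_right
    exact hh.is_zero_at_infty.mono_left atBot_le_cocompact
  have key := integral_Iic_of_hasDerivAt_of_tendsto (a := t) (hd t).continuousAt.continuousWithinAt
    (fun s _ => hd s) (i1.add i2).integrableOn hlim
  rw [integral_add i1.integrableOn i2.integrableOn, integral_const_mul, sub_zero] at key
  have hne : (2 * π * Complex.I * z : ℂ) ≠ 0 := by
    simp [hz, Real.pi_ne_zero]
  rw [eq_div_iff hne, ← key]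
  ring

lemma halfCorr_eq_integral (z : ℝ) :
    halfCorr z = ∫ t, tile (-z) 0 t * ∫ s in Set.Iic t, tile z 0 s := by
  rw [halfCorr, Measure.volume_eq_prod, integral_prod_symm _ (integrable_half_tiles _ _ _ _)]
  refine integral_congr_ae (Filter.Eventually.of_forall fun t => ?_)
  simp only
  rw [← integral_const_mul, integral_Iic_eq_integral_Iio, ← integral_indicator measurableSet_Iio]
  refine integral_congr_ae (Filter.Eventually.of_forall fun s => ?_)
  simp [Set.indicator_apply, mul_comm]

lemma integrable_tile_mul_setIntegral (z : ℝ) :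
    Integrable fun t => tile (-z) 0 t * ∫ s in Set.Iic t, tile z 0 s := by
  have := (integrable_half_tiles z (-z) 0 0).integral_prod_right
  refine this.congr (Filter.Eventually.of_forall fun t => ?_)
  simp only
  rw [← integral_const_mul, integral_Iic_eq_integral_Iio, ← integral_indicator measurableSet_Iio]
  refine integral_congr_ae (Filter.Eventually.of_forall fun s => ?_)
  simp [Set.indicator_apply, mul_comm]

lemma contDiff_window_one : ContDiff ℝ 1 window := by
  have := contDiff_infty.1 contDiff_window 1
  exact_mod_cast this

lemma contDiff_deriv_window : ContDiff ℝ 1 (deriv window) :=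
  ((contDiff_succ_iff_deriv (n := 1)).1 (by
    have := contDiff_infty.1 contDiff_window 2
    norm_num at this ⊢
    exact this)).2.2

lemma integrable_window : Integrable window :=
  contDiff_window.continuous.integrable_of_hasCompactSupport hasCompactSupport_window

lemma integrable_window_sq : Integrable fun t => window t ^ 2 := by
  have hc : Continuous fun t => window t ^ 2 := contDiff_window.continuous.pow 2
  have hs : HasCompactSupport fun t => window t ^ 2 :=
    hasCompactSupport_window.comp_left (g := fun y : ℝ => y ^ 2) (by simp)
  exact hc.integrable_of_hasCompactSupport hs

lemma halfCorr_sub_eq {z : ℝ} (hz : z ≠ 0) :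
    halfCorr z - ((∫ t, window t ^ 2 : ℝ) : ℂ) / (2 * π * Complex.I * z) =
      (∫ t, (-((window t * deriv window t : ℝ) : ℂ) + tile (-z) 0 t *
        ∫ s in Set.Iic t, ((deriv (deriv window) s : ℝ) : ℂ) * osc (z * s))) /
          (2 * π * Complex.I * z) ^ 2 := by
  have hκ : (2 * π * Complex.I * z : ℂ) ≠ 0 := by simp [hz, Real.pi_ne_zero]
  have hi : Integrable fun t => ((window t ^ 2 : ℝ) : ℂ) / (2 * π * Complex.I * z) :=
    (integrable_window_sq.ofReal (𝕜 := ℂ)).div_const _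
  rw [halfCorr_eq_integral, ← integral_complex_ofReal, ← integral_div, ← integral_sub
    (integrable_tile_mul_setIntegral z) hi, ← integral_div]
  refine integral_congr_ae (Filter.Eventually.of_forall fun t => ?_)
  have e0 : ∀ s, tile z 0 s = (window s : ℂ) * osc (z * s) := by intro s; simp [tile]
  have e1 : tile (-z) 0 t * osc (z * t) = window t := by
    rw [tile_mul_osc]; simp [tile, osc_zero]
  simp only [e0]
  rw [setIntegral_Iic_mul_osc contDiff_window_one hasCompactSupport_window hz,
    setIntegral_Iic_mul_osc contDiff_deriv_window hasCompactSupport_window.deriv hz]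
  generalize (∫ s in Set.Iic t, ((deriv (deriv window) s : ℝ) : ℂ) * osc (z * s)) = J
  generalize (2 * π * Complex.I * z : ℂ) = κ at *
  push_cast
  field_simp
  linear_combination (κ * window t - ((deriv window t : ℝ) : ℂ)) * e1

lemma exists_halfCorr_asymptotic : ∃ b : ℝ, 0 ≤ b ∧ ∀ z : ℝ, z ≠ 0 →
    ‖halfCorr z - ((∫ t, window t ^ 2 : ℝ) : ℂ) / (2 * π * Complex.I * z)‖ ≤ b / z ^ 2 := by
  have c2 : Continuous (deriv (deriv window)) := contDiff_deriv_window.continuous_deriv le_rfl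
  have i2 : Integrable (deriv (deriv window)) :=
    c2.integrable_of_hasCompactSupport hasCompactSupport_window.deriv.deriv
  set K := ∫ s, |deriv (deriv window) s| with hK
  have hK0 : 0 ≤ K := integral_nonneg fun s => abs_nonneg _
  have iB : Integrable fun t => window t * |deriv window t| + window t * K :=
    ((contDiff_window.continuous.mul
      contDiff_deriv_window.continuous.abs).integrable_of_hasCompactSupport
        hasCompactSupport_window.mul_right).add (integrable_window.mul_const K)
  have hB0 : 0 ≤ ∫ t, (window t * |deriv window t| + window t * K) :=
    integral_nonneg fun t => add_nonneg (mul_nonneg (window_nonneg t) (abs_nonneg _))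
      (mul_nonneg (window_nonneg t) hK0)
  refine ⟨∫ t, (window t * |deriv window t| + window t * K), hB0, fun z hz => ?_⟩
  have hκn : z ^ 2 ≤ ‖(2 * π * Complex.I * z : ℂ)‖ ^ 2 := by
    have : ‖(2 * π * Complex.I * z : ℂ)‖ = 2 * π * |z| := by simp [abs_of_pos Real.pi_pos]
    rw [this, mul_pow, sq_abs]
    have h1 : 1 ≤ (2 * π) ^ 2 := by nlinarith [Real.pi_gt_three]
    nlinarith [sq_nonneg z]
  rw [halfCorr_sub_eq hz, norm_div, norm_pow]
  refine div_le_div₀ hB0 ?_ (by positivity) hκn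
  refine norm_integral_le_of_norm_le iB (Filter.Eventually.of_forall fun t => ?_)
  refine (norm_add_le _ _).trans (add_le_add ?_ ?_)
  · rw [norm_neg, Complex.norm_real, norm_mul, Real.norm_of_nonneg (window_nonneg t),
      Real.norm_eq_abs]
  · rw [norm_mul, norm_tile, sub_zero]
    refine mul_le_mul_of_nonneg_left ?_ (window_nonneg t)
    refine (norm_integral_le_integral_norm _).trans ?_
    have : ∀ s, ‖((deriv (deriv window) s : ℝ) : ℂ) * osc (z * s)‖ =
        |deriv (deriv window) s| := by
      intro s; rw [norm_mul, norm_osc, mul_one, Complex.norm_real, Real.norm_eq_abs]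
    simp only [this]
    exact setIntegral_le_integral i2.abs (Filter.Eventually.of_forall fun s => abs_nonneg _)

lemma summable_one_div_succ_sq : Summable fun i : ℕ => 1 / ((i : ℝ) + 1) ^ 2 := by
  have h := (summable_nat_add_iff 1).2 (Real.summable_one_div_nat_pow.2 (by norm_num : 1 < 2))
  simpa using h

lemma exists_le_norm_sum_halfCorr : ∃ c K : ℝ, 0 < c ∧ ∀ M : ℝ, 1 ≤ M → ∀ y : ℝ, |y| ≤ 1 / 2 →
    ∀ D L : ℕ, D ≤ L → c / M * ∑ i ∈ Finset.range D, 1 / ((i : ℝ) + 1) - K ≤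
      ‖∑ d ∈ Finset.range (L + 1), halfCorr (y - M * d)‖ := by
  obtain ⟨b, hb0, hb⟩ := exists_halfCorr_asymptotic
  set a := ∫ t, window t ^ 2 with ha
  have ha0 : 0 < a := integral_window_sq_pos
  refine ⟨a / (4 * π), 4 * b * (∑' i : ℕ, 1 / ((i : ℝ) + 1) ^ 2) + 1, by positivity,
    fun M hM y hy D L hDL => ?_⟩
  have hterm : ∀ i : ℕ, a / (4 * π) / M * (1 / ((i : ℝ) + 1)) - 4 * b * (1 / ((i : ℝ) + 1) ^ 2) ≤
      (halfCorr (y - M * (i + 1 : ℕ))).im := by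
    intro i
    obtain ⟨hy1, hy2⟩ := abs_le.1 hy
    set s : ℝ := (i : ℝ) + 1 with hs
    have hs1 : 1 ≤ s := by simp [hs]
    have hcast : ((i + 1 : ℕ) : ℝ) = s := by push_cast; rfl
    rw [hcast]
    set z := y - M * s with hz
    have hMs : s ≤ M * s := by nlinarith
    have hz1 : -z ≤ 2 * (M * s) := by linarith
    have hz2 : s / 2 ≤ -z := by linarith
    have hzneg : 0 < -z := by linarith
    have h := hb z (by linarith)
    have h1 := (abs_le.1 ((Complex.abs_im_le_norm _).trans h)).1
    have him : ((a : ℂ) / (2 * π * Complex.I * z)).im = a / (2 * π * (-z)) := by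
      have : (a : ℂ) / (2 * π * Complex.I * z) = ((a / (2 * π * (-z)) : ℝ) : ℂ) * Complex.I := by
        have hzc : (z : ℂ) ≠ 0 := by exact_mod_cast (by linarith : z ≠ 0)
        have hπ : (π : ℂ) ≠ 0 := by exact_mod_cast Real.pi_ne_zero
        push_cast
        field_simp
        simp
      rw [this, Complex.mul_I_im, Complex.ofReal_re]
    rw [Complex.sub_im, him] at h1
    have e1 : a / (4 * π) / M * (1 / s) ≤ a / (2 * π * (-z)) := by
      rw [div_div, div_mul_div_comm, mul_one]
      refine div_le_div_of_nonneg_left ha0.le (by positivity) ?_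
      nlinarith [Real.pi_pos]
    have e2 : b / z ^ 2 ≤ 4 * b * (1 / s ^ 2) := by
      rw [mul_one_div, div_le_div_iff₀ (by nlinarith) (by positivity)]
      have : s ^ 2 ≤ 4 * z ^ 2 := by nlinarith
      nlinarith
    linarith
  have hsum : ∀ n : ℕ, ∑ i ∈ Finset.range n, 1 / ((i : ℝ) + 1) ^ 2 ≤
      ∑' i : ℕ, 1 / ((i : ℝ) + 1) ^ 2 := fun n =>
    summable_one_div_succ_sq.sum_le_tsum _ fun i _ => by positivity
  have h0 : -1 ≤ (halfCorr (y - M * (0 : ℕ))).im :=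
    (abs_le.1 ((Complex.abs_im_le_norm _).trans (norm_halfCorr_le _))).1
  refine le_trans ?_ ((le_abs_self _).trans (Complex.abs_im_le_norm _))
  rw [Finset.sum_range_succ', Complex.add_im, Complex.im_sum]
  have h1 := Finset.sum_le_sum fun i (_ : i ∈ Finset.range L) => hterm i
  rw [Finset.sum_sub_distrib, ← Finset.mul_sum, ← Finset.mul_sum] at h1
  have h2 : ∑ i ∈ Finset.range D, 1 / ((i : ℝ) + 1) ≤ ∑ i ∈ Finset.range L, 1 / ((i : ℝ) + 1) :=
    Finset.sum_le_sum_of_subset_of_nonneg (Finset.range_mono hDL) fun i _ _ => by positivity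
  have h3 := mul_le_mul_of_nonneg_left h2 (by positivity : 0 ≤ a / (4 * π) / M)
  have h4 := mul_le_mul_of_nonneg_left (hsum L) (by positivity : 0 ≤ 4 * b)
  have h5 := add_le_add h1 h0
  refine le_trans ?_ h5
  linarith

/-- A summable weight on the integers. -/
noncomputable def weight (d : ℤ) : ℝ := 1 / (|(d : ℝ)| + 1) ^ 2

lemma weight_nonneg (d : ℤ) : 0 ≤ weight d := by unfold weight; positivity

lemma summable_weight : Summable weight := by
  refine Summable.of_nat_of_neg ?_ ?_ <;>
  · simpa [weight] using summable_one_div_succ_sq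

lemma sum_weight_comp_le {g : ℕ → ℤ} (hg : Function.Injective g) (s : Finset ℕ) :
    ∑ k ∈ s, weight (g k) ≤ ∑' d, weight d :=
  ((summable_weight.comp_injective hg).sum_le_tsum s fun _ _ => weight_nonneg _).trans
    (tsum_comp_le_tsum_of_inj summable_weight weight_nonneg hg)

lemma exists_profile_sums : ∃ M B : ℝ, 1 ≤ M ∧ 0 < B ∧
    (∀ (g : ℕ → ℤ), Function.Injective g → ∀ (s : Finset ℕ) (x : ℝ),
      ∑ k ∈ s, ‖profile (x - M * g k)‖ ≤ B) ∧
    (∀ (y : ℝ), |y| ≤ 1 / 2 → ∀ (m : ℕ) (s : Finset ℕ), m ∉ s →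
      ∑ k ∈ s, ‖profile (y + M * m - M * k)‖ ≤ 1 / 4) ∧
    (∀ (y : ℝ), |y| ≤ 1 / 2 → ∀ (m : ℕ) (s : Finset ℕ),
      ∑ k ∈ s, ‖profile (y + M * m - M * k)‖ * |(k : ℝ) - m| ≤ B) := by
  obtain ⟨A, hA, hdecay⟩ := exists_profile_decay
  set S := ∑' d, weight d with hS
  have hS0 : 0 ≤ S := tsum_nonneg weight_nonneg
  set M := max 1 (256 * A * S) with hMdef
  have hM1 : 1 ≤ M := le_max_left _ _
  have hM2 : 256 * A * S ≤ M := le_max_right _ _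
  have far : ∀ (y : ℝ) (d : ℤ), |y| ≤ M / 2 → d ≠ 0 →
      ‖profile (y - M * d)‖ ≤ 64 * A / M / (|(d : ℝ)| + 1) ^ 3 := by
    intro y d hy hd
    have hd1 : 1 ≤ |(d : ℝ)| := by exact_mod_cast Int.one_le_abs hd
    have h1 : M * |(d : ℝ)| - |y| ≤ |y - M * d| := by
      have := abs_sub_abs_le_abs_sub (M * d : ℝ) y
      rw [abs_mul, abs_of_nonneg (by linarith : 0 ≤ M), abs_sub_comm] at this
      exact this
    have h2 : M * (|(d : ℝ)| + 1) / 4 ≤ 1 + |y - M * d| := by nlinarith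
    have h3 : M * (|(d : ℝ)| + 1) ^ 3 / 64 ≤ (1 + |y - M * d|) ^ 3 := by
      refine le_trans ?_ (pow_le_pow_left₀ (by positivity) h2 3)
      have : M ≤ M ^ 3 := le_self_pow₀ hM1 (by norm_num)
      have h4 : 0 ≤ (|(d : ℝ)| + 1) ^ 3 := by positivity
      nlinarith
    refine (hdecay _).trans ?_
    rw [div_div, div_le_div_iff₀ (by positivity) (by positivity)]
    nlinarith
  have near : ∀ (y : ℝ) (d : ℤ), |y| ≤ M / 2 →
      ‖profile (y - M * d)‖ ≤ 64 * A / (|(d : ℝ)| + 1) ^ 3 := by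
    intro y d hy
    by_cases hd : d = 0
    · subst hd
      refine (hdecay _).trans ?_
      simp only [Int.cast_zero, abs_zero, zero_add, one_pow, div_one]
      refine (div_le_self hA.le (one_le_pow₀ ?_)).trans (by linarith)
      linarith [abs_nonneg (y - M * 0)]
    · refine (far y d hy hd).trans ?_
      gcongr
      exact div_le_self (by positivity) hM1
  have w1 : ∀ d : ℤ, 1 / (|(d : ℝ)| + 1) ^ 3 ≤ weight d := fun d => by
    unfold weight
    gcongr
    · linarith [abs_nonneg (d : ℝ)]
    · norm_num
  have w2 : ∀ d : ℤ, |(d : ℝ)| / (|(d : ℝ)| + 1) ^ 3 ≤ weight d := fun d => by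
    unfold weight
    rw [div_le_div_iff₀ (by positivity) (by positivity)]
    have := abs_nonneg (d : ℝ)
    have h4 : 0 ≤ (|(d : ℝ)| + 1) ^ 2 := by positivity
    nlinarith
  have cast : ∀ (y : ℝ) (m k : ℕ), y + M * m - M * k = y - M * ((k - m : ℤ) : ℝ) := by
    intro y m k; push_cast; ring
  have inj : ∀ m : ℕ, Function.Injective fun k : ℕ => (k - m : ℤ) := by
    intro m a b h; simpa using h
  refine ⟨M, 64 * A * S + 1, hM1, by positivity, ?_, ?_, ?_⟩
  · intro g hg s x
    set m := round (x / M) with hm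
    have hx : |x - M * m| ≤ M / 2 := by
      have := abs_sub_round (x / M)
      rw [← hm] at this
      have e : x - M * m = M * (x / M - m) := by field_simp
      rw [e, abs_mul, abs_of_nonneg (by linarith : 0 ≤ M)]
      nlinarith
    have : ∀ k ∈ s, ‖profile (x - M * g k)‖ ≤ 64 * A * weight (g k - m) := by
      intro k _
      have e : x - M * g k = (x - M * m) - M * ((g k - m : ℤ) : ℝ) := by push_cast; ring
      rw [e]
      refine (near _ _ hx).trans ?_
      rw [div_eq_mul_one_div]
      exact mul_le_mul_of_nonneg_left (w1 _) (by positivity)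
    refine (Finset.sum_le_sum this).trans ?_
    rw [← Finset.mul_sum]
    have h := sum_weight_comp_le (g := fun k => g k - m) (fun a b h => hg (by simpa using h)) s
    nlinarith
  · intro y hy m s hms
    have : ∀ k ∈ s, ‖profile (y + M * m - M * k)‖ ≤ 64 * A / M * weight (k - m) := by
      intro k hk
      rw [cast]
      refine (far _ _ (by linarith) ?_).trans ?_
      · intro h
        have : k = m := by omega
        exact hms (this ▸ hk)
      · rw [div_eq_mul_one_div]
        exact mul_le_mul_of_nonneg_left (w1 _) (by positivity)
    refine (Finset.sum_le_sum this).trans ?_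
    rw [← Finset.mul_sum]
    have h := sum_weight_comp_le (inj m) s
    have h2 := mul_le_mul_of_nonneg_left h (by positivity : 0 ≤ 64 * A / M)
    refine h2.trans ?_
    rw [div_mul_eq_mul_div, div_le_iff₀ (by positivity)]
    linarith
  · intro y hy m s
    have : ∀ k ∈ s, ‖profile (y + M * m - M * k)‖ * |(k : ℝ) - m| ≤ 64 * A * weight (k - m) := by
      intro k hk
      rw [cast]
      have h1 := near y (k - m) (by linarith)
      have h2 := w2 (k - m)
      have e : ((k - m : ℤ) : ℝ) = (k : ℝ) - m := by push_cast; rfl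
      rw [e] at h1 h2 ⊢
      refine (mul_le_mul_of_nonneg_right h1 (abs_nonneg _)).trans ?_
      rw [div_mul_eq_mul_div, mul_div_assoc]
      exact mul_le_mul_of_nonneg_left h2 (by positivity)
    refine (Finset.sum_le_sum this).trans ?_
    rw [← Finset.mul_sum]
    have h := sum_weight_comp_le (inj m) s
    nlinarith

lemma exists_measurePreserving_split (m : ℕ) :
    ∃ e : (Fin (m + 2) → ℝ) ≃ᵐ (ℝ × ℝ) × (Fin m → ℝ), MeasurePreserving e volume volume ∧
      ∀ t, e t = ((t (Fin.last _), t (Fin.last m).castSucc),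
        fun i => t i.castSucc.castSucc) := by
  let e1 := MeasurableEquiv.piFinSuccAbove (fun _ : Fin (m + 2) => ℝ) (Fin.last (m + 1))
  let e2 := MeasurableEquiv.piFinSuccAbove (fun _ : Fin (m + 1) => ℝ) (Fin.last m)
  have h1 : MeasurePreserving e1 volume volume := volume_preserving_piFinSuccAbove _ _
  have h2 : MeasurePreserving e2 volume volume := volume_preserving_piFinSuccAbove _ _
  have h3 : MeasurePreserving ((MeasurableEquiv.refl ℝ).prodCongr e2)
      (volume : Measure (ℝ × (Fin (m + 1) → ℝ))) volume :=
    (MeasurePreserving.id volume).prod h2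
  have h4 : MeasurePreserving (MeasurableEquiv.prodAssoc (α := ℝ) (β := ℝ)
      (γ := Fin m → ℝ)).symm volume volume :=
    (measurePreserving_prodAssoc volume volume volume).symm _
  refine ⟨(e1.trans ((MeasurableEquiv.refl ℝ).prodCongr e2)).trans MeasurableEquiv.prodAssoc.symm,
    (h1.trans h3).trans h4, fun t => ?_⟩
  refine Prod.ext (Prod.ext rfl ?_) ?_
  · change t ((Fin.last (m + 1)).succAbove (Fin.last m)) = _
    rw [Fin.succAbove_last]
  · funext i
    change t ((Fin.last (m + 1)).succAbove ((Fin.last m).succAbove i)) = _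
    rw [Fin.succAbove_last, Fin.succAbove_last]

lemma integral_prod_mul_last_two {m : ℕ} (g : Fin m → ℝ → ℂ) (q : ℝ × ℝ → ℂ) :
    ∫ t : Fin (m + 2) → ℝ, (∏ i, g i (t i.castSucc.castSucc)) *
      q (t (Fin.last m).castSucc, t (Fin.last _)) = (∏ i, ∫ s, g i s) * ∫ s, q s := by
  obtain ⟨e, he, het⟩ := exists_measurePreserving_split m
  have h := he.integral_comp' (fun s : (ℝ × ℝ) × (Fin m → ℝ) => q s.1.swap * ∏ i, g i (s.2 i))
  simp only [het, Prod.swap_prod_mk] at h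
  have h2 : ∫ s : (ℝ × ℝ) × (Fin m → ℝ), q s.1.swap * ∏ i, g i (s.2 i) =
      (∫ s : ℝ × ℝ, q s.swap) * ∫ u : Fin m → ℝ, ∏ i, g i (u i) :=
    integral_prod_mul (fun s : ℝ × ℝ => q s.swap) fun u : Fin m → ℝ => ∏ i, g i (u i)
  have h3 : ∫ s : ℝ × ℝ, q s.swap = ∫ s, q s := integral_prod_swap (μ := volume) (ν := volume) q
  rw [h2, h3, integral_fintype_prod_volume_eq_prod] at h
  rw [mul_comm, ← h]
  exact integral_congr_ae (Filter.Eventually.of_forall fun t => mul_comm _ _)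

lemma integrable_prod_mul_last_two {m : ℕ} {g : Fin m → ℝ → ℂ} {q : ℝ × ℝ → ℂ}
    (hg : ∀ i, Integrable (g i)) (hq : Integrable q) :
    Integrable fun t : Fin (m + 2) → ℝ => (∏ i, g i (t i.castSucc.castSucc)) *
      q (t (Fin.last m).castSucc, t (Fin.last _)) := by
  obtain ⟨e, he, het⟩ := exists_measurePreserving_split m
  have h : Integrable (fun s : (ℝ × ℝ) × (Fin m → ℝ) => q s.1.swap * ∏ i, g i (s.2 i)) :=
    hq.swap.mul_prod (Integrable.fintype_prod hg)
  have h2 := (he.integrable_comp_emb e.measurableEmbedding).2 h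
  refine h2.congr (Filter.Eventually.of_forall fun t => ?_)
  simp only [Function.comp, het, Prod.swap_prod_mk]
  exact mul_comm _ _

/-- A sum of `N` tiles at frequencies `l, l + 2, …`, modulated by `s * x`. -/
noncomputable def packet (M : ℝ) (N : ℕ) (s l x t : ℝ) : ℂ :=
  ∑ k ∈ Finset.range N, tile (s * (x - M * k)) (l + 2 * k) t

lemma packet_mul_osc (M : ℝ) (N : ℕ) (s l x t : ℝ) :
    packet M N s l 0 t * osc (s * x * t) = packet M N s l x t := by
  rw [packet, packet, Finset.sum_mul]
  refine Finset.sum_congr rfl fun k _ => ?_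
  rw [tile_mul_osc]
  ring_nf

lemma contDiff_packet (M : ℝ) (N : ℕ) (s l x : ℝ) :
    ContDiff ℝ ((⊤ : ℕ∞) : WithTop ℕ∞) (packet M N s l x) :=
  ContDiff.sum fun _ _ => contDiff_tile _ _

lemma mem_Ioo_of_packet_ne_zero {M : ℝ} {N : ℕ} {s l x t : ℝ} (h : packet M N s l x t ≠ 0) :
    t ∈ Set.Ioo l (l + 2 * N) := by
  obtain ⟨k, hk, hne⟩ := Finset.exists_ne_zero_of_sum_ne_zero h
  have h1 := mem_Ioo_of_tile_ne_zero hne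
  have h2 : (k : ℝ) + 1 ≤ N := by exact_mod_cast Finset.mem_range.1 hk
  have h3 : (0 : ℝ) ≤ k := k.cast_nonneg
  constructor <;> linarith [h1.1, h1.2]

lemma hasCompactSupport_packet (M : ℝ) (N : ℕ) (s l x : ℝ) :
    HasCompactSupport (packet M N s l x) := by
  apply HasCompactSupport.intro (isCompact_Icc (a := l) (b := l + 2 * N))
  intro t ht
  by_contra h
  exact ht (Set.Ioo_subset_Icc_self (mem_Ioo_of_packet_ne_zero h))

lemma integrable_packet (M : ℝ) (N : ℕ) (s l x : ℝ) : Integrable (packet M N s l x) :=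
  (contDiff_packet M N s l x).continuous.integrable_of_hasCompactSupport
    (hasCompactSupport_packet M N s l x)

lemma integral_packet (M : ℝ) (N : ℕ) (s l x : ℝ) : ∫ t, packet M N s l x t =
    ∑ k ∈ Finset.range N, osc (s * (x - M * k) * (l + 2 * k)) * profile (s * (x - M * k)) := by
  simp only [packet]
  rw [integral_finsetSum _ fun k _ => integrable_tile _ _]
  exact Finset.sum_congr rfl fun k _ => integral_tile _ _

/-- The Schwartz function whose Fourier transform is a packet. -/
noncomputable def packetFun (M : ℝ) (N : ℕ) (s l : ℝ) : SchwartzMap ℝ ℂ :=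
  𝓕⁻ ((hasCompactSupport_packet M N s l 0).toSchwartzMap (contDiff_packet M N s l 0) :
    SchwartzMap ℝ ℂ)

lemma fourier_packetFun (M : ℝ) (N : ℕ) (s l : ℝ) :
    𝓕 ⇑(packetFun M N s l) = packet M N s l 0 := by
  rw [packetFun, ← SchwartzMap.fourier_coe, FourierInvPair.fourier_fourierInv_eq]
  rfl

lemma packetFun_apply (M : ℝ) (N : ℕ) {s : ℝ} (hs : s * s = 1) (l x : ℝ) :
    packetFun M N s l x = ∫ t, packet M N s l (s * x) t := by
  rw [packetFun, SchwartzMap.fourierInv_coe, fourierInv_eq_integral_osc]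
  refine integral_congr_ae (Filter.Eventually.of_forall fun t => ?_)
  have : s * (s * x) * t = x * t := by rw [← mul_assoc, hs, one_mul]
  rw [← packet_mul_osc, this]
  rfl

lemma tile_mul_tile_eq_ite (z w a b : ℝ) (j k : ℕ) :
    (if j ≤ k then tile z (2 * j) a * tile w (1 + 2 * k) b else 0) =
      if a < b then tile z (2 * j) a * tile w (1 + 2 * k) b else 0 := by
  by_cases h : tile z (2 * j) a * tile w (1 + 2 * k) b = 0
  · simp [h]
  have h1 := mem_Ioo_of_tile_ne_zero (left_ne_zero_of_mul h)
  have h2 := mem_Ioo_of_tile_ne_zero (right_ne_zero_of_mul h)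
  have : j ≤ k ↔ a < b := by
    constructor
    · intro hjk
      have : (j : ℝ) ≤ k := by exact_mod_cast hjk
      linarith [h1.2, h2.1]
    · intro hab
      by_contra hjk
      have : (k : ℝ) + 1 ≤ j := by exact_mod_cast (not_le.1 hjk)
      linarith [h1.1, h2.2]
  simp only [this]

/-- The ordered part of the product of the tiles of the last three inputs, for a fixed tile `j`
of the first of them. -/
noncomputable def pairSum (M x : ℝ) (N j : ℕ) (q : ℝ × ℝ) : ℂ :=
  ∑ k ∈ Finset.Ico j N, ∑ l ∈ Finset.range N, {q : ℝ × ℝ | q.1 < q.2}.indicator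
    (fun q => tile (x - M * k) (1 + 2 * k) q.1 * tile (-(x - M * l)) (1 + 2 * l) q.2) q

lemma sum_tile_mul_pairSum (M x : ℝ) (N : ℕ) (a b c : ℝ) :
    ∑ j ∈ Finset.range N, tile (x - M * j) (2 * j) a * pairSum M x N j (b, c) =
      if a < b ∧ b < c then (∑ j ∈ Finset.range N, tile (x - M * j) (2 * j) a) *
        (∑ k ∈ Finset.range N, tile (x - M * k) (1 + 2 * k) b) *
        (∑ l ∈ Finset.range N, tile (-(x - M * l)) (1 + 2 * l) c) else 0 := by
  by_cases hbc : b < c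
  swap
  · simp [pairSum, hbc]
  have h1 : ∀ j, pairSum M x N j (b, c) = (∑ k ∈ Finset.range N,
      if j ≤ k then tile (x - M * k) (1 + 2 * k) b else 0) *
        ∑ l ∈ Finset.range N, tile (-(x - M * l)) (1 + 2 * l) c := by
    intro j
    have : Finset.Ico j N = (Finset.range N).filter (j ≤ ·) := by
      ext k; simp [and_comm]
    rw [pairSum, this, Finset.sum_filter, Finset.sum_mul]
    refine Finset.sum_congr rfl fun k _ => ?_
    simp only [Set.indicator_apply, Set.mem_ofPred_eq, hbc, if_true]
    split_ifs
    · rw [Finset.mul_sum]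
    · rw [zero_mul]
  simp only [h1, ← mul_assoc, ← Finset.sum_mul, hbc, and_true]
  rw [← ite_zero_mul]
  congr 1
  have h2 : ∀ j k : ℕ, tile (x - M * j) (2 * j) a *
      (if j ≤ k then tile (x - M * k) (1 + 2 * k) b else 0) =
      if a < b then tile (x - M * j) (2 * j) a * tile (x - M * k) (1 + 2 * k) b else 0 := by
    intro j k
    rw [← tile_mul_tile_eq_ite, mul_ite, mul_zero]
  simp only [Finset.mul_sum, h2]
  split_ifs
  · simp only [← Finset.mul_sum, ← Finset.sum_mul]
  · simp

lemma integrable_pairSum (M x : ℝ) (N j : ℕ) : Integrable (pairSum M x N j) :=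
  integrable_finsetSum _ fun _ _ => integrable_finsetSum _ fun _ _ => integrable_half_tiles _ _ _ _

/-- The frequency offsets of the inputs: consecutive blocks, the last three blocks interlacing. -/
noncomputable def offset (m N i : ℕ) : ℝ := if i ≤ m then 2 * N * ((i : ℝ) - m) else 1

/-- The sign pattern `(1, …, 1, -1)`. -/
noncomputable def lastSign (m i : ℕ) : ℝ := if i = m + 2 then -1 else 1

lemma lastSign_mul_self (m i : ℕ) : lastSign m i * lastSign m i = 1 := by
  unfold lastSign; split_ifs <;> norm_num

lemma strictMono_of_packet_ne_zero {m N : ℕ} {M x : ℝ} {t : Fin (m + 3) → ℝ}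
    (h : ∀ i : Fin (m + 3), packet M N (lastSign m i) (offset m N i) x (t i) ≠ 0)
    (h1 : t (Fin.last m).castSucc.castSucc < t (Fin.last (m + 1)).castSucc)
    (h2 : t (Fin.last (m + 1)).castSucc < t (Fin.last (m + 2))) : StrictMono t := by
  rw [Fin.strictMono_iff_lt_succ]
  intro i
  rcases Nat.lt_trichotomy i.val m with hi | hi | hi
  · have ha := (mem_Ioo_of_packet_ne_zero (h i.castSucc)).2
    have hb := (mem_Ioo_of_packet_ne_zero (h i.succ)).1
    simp only [offset, Fin.val_castSucc, Fin.val_succ, hi.le, Nat.succ_le_of_lt hi, if_true] at ha hb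
    push_cast at hb
    linarith
  · have e : i = (Fin.last m).castSucc := Fin.ext hi
    subst e; exact h1
  · have e : i = Fin.last (m + 1) := Fin.ext (by simp; omega)
    subst e; exact h2

lemma packet_first (m N : ℕ) (M x t : ℝ) : packet M N (lastSign m m) (offset m N m) x t =
    ∑ j ∈ Finset.range N, tile (x - M * j) (2 * j) t := by
  simp [packet, lastSign, offset]

lemma packet_second (m N : ℕ) (M x t : ℝ) :
    packet M N (lastSign m (m + 1)) (offset m N (m + 1)) x t =
      ∑ j ∈ Finset.range N, tile (x - M * j) (1 + 2 * j) t := by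
  simp [packet, lastSign, offset]

lemma packet_third (m N : ℕ) (M x t : ℝ) :
    packet M N (lastSign m (m + 2)) (offset m N (m + 2)) x t =
      ∑ j ∈ Finset.range N, tile (-(x - M * j)) (1 + 2 * j) t := by
  simp [packet, lastSign, offset]

lemma indicator_strictMono_prod_packet (m N : ℕ) (M x : ℝ) (t : Fin (m + 3) → ℝ) :
    {t : Fin (m + 3) → ℝ | StrictMono t}.indicator
      (fun t => ∏ i : Fin (m + 3), packet M N (lastSign m i) (offset m N i) x (t i)) t =
    ∑ j ∈ Finset.range N, (∏ i : Fin (m + 1), (if i = Fin.last m then tile (x - M * j) (2 * j)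
      else packet M N (lastSign m i) (offset m N i) x) (t i.castSucc.castSucc)) *
        pairSum M x N j (t (Fin.last (m + 1)).castSucc, t (Fin.last (m + 2))) := by
  simp only [Fin.prod_univ_castSucc, Fin.castSucc_ne_last, if_false, if_true]
  simp only [mul_assoc, ← Finset.mul_sum]
  simp only [Set.indicator_apply, Set.mem_ofPred_eq, Fin.val_castSucc, Fin.val_last]
  rw [sum_tile_mul_pairSum, packet_first, packet_second, packet_third]
  split_ifs with h1 h2 h2
  · simp only [mul_assoc]
  · exact absurd ⟨h1 (Fin.castSucc_lt_castSucc_iff.2 (Fin.castSucc_lt_last _)),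
      h1 (Fin.castSucc_lt_last _)⟩ h2
  · by_contra hne
    apply h1
    refine strictMono_of_packet_ne_zero (m := m) (N := N) (M := M) (x := x) ?_ h2.1 h2.2
    have : ∏ i : Fin (m + 3), packet M N (lastSign m i) (offset m N i) x (t i) ≠ 0 := by
      simp only [Fin.prod_univ_castSucc, Fin.val_castSucc, Fin.val_last]
      rw [packet_first, packet_second, packet_third]
      rw [mul_assoc, mul_assoc, ← mul_assoc (∑ j ∈ _, _)]
      exact Ne.symm hne
    exact fun i => Finset.prod_ne_zero_iff.1 this i (Finset.mem_univ i)
  · rw [mul_zero]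

lemma measurableSet_strictMono (m : ℕ) :
    MeasurableSet {t : Fin (m + 1) → ℝ | StrictMono t} := by
  simp only [Fin.strictMono_iff_lt_succ, Set.ofPred_forall]
  exact MeasurableSet.iInter fun i => measurableSet_lt (measurable_pi_apply _) (measurable_pi_apply _)

lemma osc_sum {ι : Type*} (s : Finset ι) (r : ι → ℝ) : osc (∑ i ∈ s, r i) = ∏ i ∈ s, osc (r i) := by
  classical
  induction s using Finset.induction_on with
  | empty => simp [osc_zero]
  | insert a s ha ih => rw [Finset.sum_insert ha, Finset.prod_insert ha, osc_add, ih]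

lemma Cop_packetFun (m N : ℕ) (M x : ℝ) :
    Cop (fun i : Fin (m + 3) => lastSign m i)
      (fun i => ⇑(packetFun M N (lastSign m i) (offset m N i))) x =
    (∏ i : Fin m, ∫ t, packet M N 1 (offset m N i) x t) * ∑ j ∈ Finset.range N,
      (∫ t, tile (x - M * j) (2 * j) t) * ∫ q, pairSum M x N j q := by
  have hint : ∀ t : Fin (m + 3) → ℝ,
      (∏ i : Fin (m + 3), 𝓕 ⇑(packetFun M N (lastSign m i) (offset m N i)) (t i)) *
        Complex.exp (2 * π * Complex.I * x * ∑ i : Fin (m + 3), lastSign m i * t i) =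
      ∏ i : Fin (m + 3), packet M N (lastSign m i) (offset m N i) x (t i) := by
    intro t
    have : Complex.exp (2 * π * Complex.I * x * ∑ i : Fin (m + 3), lastSign m i * t i) =
        osc (∑ i : Fin (m + 3), lastSign m i * x * t i) := by
      rw [osc]
      congr 1
      push_cast
      rw [Finset.mul_sum, Finset.mul_sum]
      exact Finset.sum_congr rfl fun i _ => by ring
    rw [this, osc_sum, ← Finset.prod_mul_distrib]
    refine Finset.prod_congr rfl fun i _ => ?_
    rw [fourier_packetFun, packet_mul_osc]
  rw [Cop]
  simp only [hint]
  rw [← integral_indicator (measurableSet_strictMono (m + 2))]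
  simp only [indicator_strictMono_prod_packet]
  rw [integral_finsetSum]
  swap
  · intro j _
    refine integrable_prod_mul_last_two (g := fun i : Fin (m + 1) =>
      if i = Fin.last m then tile (x - M * j) (2 * j)
      else packet M N (lastSign m i) (offset m N i) x) (fun i => ?_) (integrable_pairSum M x N j)
    split_ifs
    · exact integrable_tile _ _
    · exact integrable_packet _ _ _ _ _
  rw [Finset.mul_sum]
  refine Finset.sum_congr rfl fun j _ => ?_
  rw [integral_prod_mul_last_two (fun i : Fin (m + 1) =>
      if i = Fin.last m then tile (x - M * j) (2 * j)
      else packet M N (lastSign m i) (offset m N i) x)]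
  simp only [Fin.prod_univ_castSucc, Fin.castSucc_ne_last, if_false, if_true]
  rw [mul_assoc]
  congr 1
  refine Finset.prod_congr rfl fun i _ => ?_
  have : lastSign m (i.castSucc : Fin (m + 1)) = 1 := by
    have := i.isLt
    simp only [lastSign, Fin.val_castSucc]
    rw [if_neg (by omega)]
  rw [this, Fin.val_castSucc]

lemma half_le_norm_sum {M y : ℝ} (hy : 3 / 4 ≤ ‖profile y‖) {i N : ℕ} (hi : i < N)
    (hsum : ∀ s : Finset ℕ, i ∉ s → ∑ k ∈ s, ‖profile (y + M * i - M * k)‖ ≤ 1 / 4)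
    {u : ℕ → ℂ} (hu : ∀ k, ‖u k‖ = ‖profile (y + M * i - M * k)‖) :
    1 / 2 ≤ ‖∑ k ∈ Finset.range N, u k‖ := by
  rw [← Finset.add_sum_erase _ _ (Finset.mem_range.2 hi)]
  have h1 : ‖∑ k ∈ (Finset.range N).erase i, u k‖ ≤ 1 / 4 := by
    refine (norm_sum_le _ _).trans ?_
    simp only [hu]
    exact hsum _ (Finset.notMem_erase _ _)
  have h2 : 3 / 4 ≤ ‖u i‖ := by rw [hu]; simpa using hy
  have h3 := norm_sub_le_norm_add (u i) (∑ k ∈ (Finset.range N).erase i, u k)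
  linarith

lemma norm_sum_half_tiles_sub_le (M x : ℝ) {k N : ℕ} (hk : k < N) :
    ‖(∑ l ∈ Finset.range N, ∫ q : ℝ × ℝ, {q : ℝ × ℝ | q.1 < q.2}.indicator
      (fun q => tile (x - M * k) (1 + 2 * k) q.1 * tile (-(x - M * l)) (1 + 2 * l) q.2) q) -
        halfCorr (x - M * k)‖ ≤
      ‖profile (x - M * k)‖ * ∑ l ∈ Finset.range N, ‖profile (-(x - M * l))‖ := by
  rw [← Finset.add_sum_erase _ _ (Finset.mem_range.2 hk), integral_half_tiles_diag,
    add_sub_cancel_left, Finset.mul_sum]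
  refine (norm_sum_le _ _).trans ((Finset.sum_le_sum fun l hl => ?_).trans
    (Finset.sum_le_sum_of_subset_of_nonneg (Finset.erase_subset k _) fun _ _ _ => by positivity))
  rcases lt_or_gt_of_ne (Finset.ne_of_mem_erase hl) with h | h
  · have h' : (l : ℝ) + 1 ≤ k := by exact_mod_cast h
    rw [integral_half_tiles_gt (by linarith), norm_zero]
    positivity
  · have h' : (k : ℝ) + 1 ≤ l := by exact_mod_cast h
    rw [integral_half_tiles_lt (by linarith), norm_mul, norm_integral_tile, norm_integral_tile]

lemma integral_pairSum (M x : ℝ) (N j : ℕ) : ∫ q, pairSum M x N j q =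
    ∑ k ∈ Finset.Ico j N, ∑ l ∈ Finset.range N, ∫ q : ℝ × ℝ, {q : ℝ × ℝ | q.1 < q.2}.indicator
      (fun q => tile (x - M * k) (1 + 2 * k) q.1 * tile (-(x - M * l)) (1 + 2 * l) q.2) q := by
  simp only [pairSum]
  rw [integral_finsetSum _ fun k _ => integrable_finsetSum _ fun l _ =>
    integrable_half_tiles _ _ _ _]
  exact Finset.sum_congr rfl fun k _ => integral_finsetSum _ fun l _ =>
    integrable_half_tiles _ _ _ _

lemma norm_integral_pairSum_sub_le {M B x : ℝ} (hB0 : 0 ≤ B) (hB : ∀ (g : ℕ → ℤ),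
      Function.Injective g → ∀ (s : Finset ℕ) (x : ℝ), ∑ k ∈ s, ‖profile (x - M * g k)‖ ≤ B)
    (N j : ℕ) :
    ‖(∫ q, pairSum M x N j q) - ∑ k ∈ Finset.Ico j N, halfCorr (x - M * k)‖ ≤ B ^ 2 := by
  have h1 : ∑ l ∈ Finset.range N, ‖profile (-(x - M * l))‖ ≤ B := by
    refine le_trans (le_of_eq ?_) (hB (fun l => -(l : ℤ)) (fun a b h => by simpa using h)
      (Finset.range N) (-x))
    refine Finset.sum_congr rfl fun l _ => ?_
    push_cast
    ring_nf
  have h2 : ∑ k ∈ Finset.Ico j N, ‖profile (x - M * k)‖ ≤ B := by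
    simpa using hB (fun l => (l : ℤ)) Nat.cast_injective (Finset.Ico j N) x
  rw [integral_pairSum, ← Finset.sum_sub_distrib]
  refine (norm_sum_le _ _).trans ?_
  calc _ ≤ ∑ k ∈ Finset.Ico j N, ‖profile (x - M * k)‖ * B :=
        Finset.sum_le_sum fun k hk => (norm_sum_half_tiles_sub_le M x
          (Finset.mem_Ico.1 hk).2).trans (mul_le_mul_of_nonneg_left h1 (norm_nonneg _))
    _ ≤ B ^ 2 := by
        rw [← Finset.sum_mul, sq]
        exact mul_le_mul_of_nonneg_right h2 hB0

lemma norm_sum_Ico_sub_le {f : ℕ → ℂ} (hf : ∀ k, ‖f k‖ ≤ 1) {i j N : ℕ} (hi : i ≤ N)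
    (hj : j ≤ N) :
    ‖∑ k ∈ Finset.Ico j N, f k - ∑ k ∈ Finset.Ico i N, f k‖ ≤ |(j : ℝ) - i| := by
  wlog h : i ≤ j generalizing i j
  · rw [norm_sub_rev, abs_sub_comm]
    exact this hj hi (not_le.1 h).le
  rw [← Finset.sum_Ico_consecutive f h hj, sub_add_cancel_right, norm_neg]
  have h' : (i : ℝ) ≤ j := by exact_mod_cast h
  rw [abs_of_nonneg (by linarith)]
  refine (norm_sum_le_of_le _ fun k _ => hf k).trans ?_
  simp [Nat.cast_sub h]

lemma exists_packet_constants : ∃ M B δ c K : ℝ, 1 ≤ M ∧ 0 < B ∧ 0 < δ ∧ δ < 1 / 2 ∧ 0 < c ∧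
    (∀ (g : ℕ → ℤ), Function.Injective g → ∀ (s : Finset ℕ) (x : ℝ),
      ∑ k ∈ s, ‖profile (x - M * g k)‖ ≤ B) ∧
    ∀ (m D i : ℕ) (y : ℝ), i < D → |y| ≤ δ →
      (1 / 2) ^ m * (c * ∑ r ∈ Finset.range D, 1 / ((r : ℝ) + 1) - K) ≤
        ‖Cop (fun i : Fin (m + 3) => lastSign m i)
          (fun i => ⇑(packetFun M (2 * D) (lastSign m i) (offset m (2 * D) i))) (y + M * i)‖ := by
  obtain ⟨M, B, hM, hB0, hB1, hB2, hB3⟩ := exists_profile_sums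
  obtain ⟨c, K, hc, hcK⟩ := exists_le_norm_sum_halfCorr
  obtain ⟨δ', hδ', hδ⟩ := Metric.continuousAt_iff.1 (continuous_profile.continuousAt (x := 0))
    (1 / 4) (by norm_num)
  refine ⟨M, B, min (δ' / 2) (1 / 4), c / M / 2, K / 2 + B + B ^ 3, hM, hB0, by positivity,
    (min_le_right _ _).trans_lt (by norm_num), by positivity, hB1, fun m D i y hi hy => ?_⟩
  have hy1 : |y| ≤ 1 / 2 := (hy.trans (min_le_right _ _)).trans (by norm_num)
  have hy2 : 3 / 4 ≤ ‖profile y‖ := by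
    have h1 : dist y 0 < δ' := by
      rw [Real.dist_eq, sub_zero]
      linarith [hy.trans (min_le_left _ _)]
    have h2 := hδ h1
    rw [profile_zero, dist_eq_norm] at h2
    have h3 := norm_sub_norm_le 1 (profile y)
    rw [norm_one, norm_sub_rev] at h3
    linarith
  have hiN : i < 2 * D := by omega
  set x := y + M * i with hx
  have hhalf : ∀ {u : ℕ → ℂ}, (∀ k, ‖u k‖ = ‖profile (x - M * k)‖) →
      1 / 2 ≤ ‖∑ k ∈ Finset.range (2 * D), u k‖ := fun hu =>
    half_le_norm_sum hy2 hiN (hB2 y hy1 i) hu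
  rw [Cop_packetFun, norm_mul, norm_prod]
  have hprod : (1 / 2 : ℝ) ^ m ≤
      ∏ r : Fin m, ‖∫ t, packet M (2 * D) 1 (offset m (2 * D) r) x t‖ := by
    have : (1 / 2 : ℝ) ^ m = ∏ _r : Fin m, (1 / 2 : ℝ) := by simp
    rw [this]
    refine Finset.prod_le_prod (fun _ _ => by norm_num) fun r _ => ?_
    rw [integral_packet]
    refine hhalf fun k => ?_
    rw [norm_mul, norm_osc, one_mul, one_mul]
  refine le_trans (mul_le_mul_of_nonneg_left ?_ (by positivity))
    (mul_le_mul_of_nonneg_right hprod (norm_nonneg _))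
  set u : ℕ → ℂ := fun j => ∫ t, tile (x - M * j) (2 * j) t with hu
  have hun : ∀ j, ‖u j‖ = ‖profile (x - M * j)‖ := fun j => norm_integral_tile _ _
  set V : ℕ → ℂ := fun j => ∑ k ∈ Finset.Ico j (2 * D), halfCorr (x - M * k) with hV
  have hVi : c / M * ∑ r ∈ Finset.range D, 1 / ((r : ℝ) + 1) - K ≤ ‖V i‖ := by
    refine (hcK M hM y hy1 D (2 * D - i - 1) (by omega)).trans (le_of_eq ?_)
    rw [hV]
    simp only
    rw [Finset.sum_Ico_eq_sum_range, show 2 * D - i - 1 + 1 = 2 * D - i by omega]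
    congr 1
    refine Finset.sum_congr rfl fun d _ => ?_
    rw [hx]
    push_cast
    ring_nf
  have hsplit : ∑ j ∈ Finset.range (2 * D), u j * ∫ q, pairSum M x (2 * D) j q =
      (∑ j ∈ Finset.range (2 * D), u j) * V i + ∑ j ∈ Finset.range (2 * D),
        u j * ((∫ q, pairSum M x (2 * D) j q) - V i) := by
    rw [Finset.sum_mul, ← Finset.sum_add_distrib]
    exact Finset.sum_congr rfl fun j _ => by ring
  have herr : ‖∑ j ∈ Finset.range (2 * D), u j * ((∫ q, pairSum M x (2 * D) j q) - V i)‖ ≤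
      B + B ^ 3 := by
    have hterm : ∀ j ∈ Finset.range (2 * D),
        ‖u j * ((∫ q, pairSum M x (2 * D) j q) - V i)‖ ≤
          ‖profile (x - M * j)‖ * |(j : ℝ) - i| + ‖profile (x - M * j)‖ * B ^ 2 := by
      intro j hj
      rw [norm_mul, hun, ← mul_add]
      refine mul_le_mul_of_nonneg_left ?_ (norm_nonneg _)
      have h1 := norm_integral_pairSum_sub_le (x := x) hB0.le hB1 (2 * D) j
      have h2 := norm_sum_Ico_sub_le (f := fun k : ℕ => halfCorr (x - M * k))
        (fun k => norm_halfCorr_le _) hiN.le (Finset.mem_range.1 hj).le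
      have h3 := norm_sub_le_norm_sub_add_norm_sub (∫ q, pairSum M x (2 * D) j q) (V j) (V i)
      linarith
    refine (norm_sum_le _ _).trans ((Finset.sum_le_sum hterm).trans ?_)
    rw [Finset.sum_add_distrib, ← Finset.sum_mul]
    have h1 := hB3 y hy1 i (Finset.range (2 * D))
    have h2 : ∑ k ∈ Finset.range (2 * D), ‖profile (x - M * k)‖ ≤ B := by
      simpa using hB1 (fun l => (l : ℤ)) Nat.cast_injective (Finset.range (2 * D)) x
    have h3 := mul_le_mul_of_nonneg_right h2 (sq_nonneg B)
    have h4 : B ^ 3 = B * B ^ 2 := by ring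
    rw [h4]
    exact add_le_add h1 h3
  have hmain : 1 / 2 * ‖V i‖ ≤ ‖(∑ j ∈ Finset.range (2 * D), u j) * V i‖ := by
    rw [norm_mul]
    exact mul_le_mul_of_nonneg_right (hhalf hun) (norm_nonneg _)
  rw [hsplit]
  have h5 := norm_sub_le_norm_add ((∑ j ∈ Finset.range (2 * D), u j) * V i)
    (∑ j ∈ Finset.range (2 * D), u j * ((∫ q, pairSum M x (2 * D) j q) - V i))
  have h6 : c / M / 2 * ∑ r ∈ Finset.range D, 1 / ((r : ℝ) + 1) =
    1 / 2 * (c / M * ∑ r ∈ Finset.range D, 1 / ((r : ℝ) + 1)) := by ring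
  linarith

lemma norm_packetFun_le (M : ℝ) (N : ℕ) {s : ℝ} (hs : s * s = 1) (l : ℝ) :
    ∃ g : ℕ → ℤ, Function.Injective g ∧
      ∀ x, ‖packetFun M N s l x‖ ≤ ∑ k ∈ Finset.range N, ‖profile (x - M * g k)‖ := by
  obtain ⟨g, hg, hsg⟩ : ∃ g : ℕ → ℤ, Function.Injective g ∧ ∀ k : ℕ, (g k : ℝ) = s * k := by
    rcases mul_self_eq_one_iff.1 hs with rfl | rfl
    · exact ⟨fun k => k, Nat.cast_injective, fun k => by simp⟩
    · exact ⟨fun k => -k, fun a b h => by simpa using h, fun k => by simp⟩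
  refine ⟨g, hg, fun x => ?_⟩
  rw [packetFun_apply M N hs, integral_packet]
  refine norm_sum_le_of_le _ fun k _ => le_of_eq ?_
  rw [norm_mul, norm_osc, one_mul, hsg]
  congr 2
  linear_combination x * hs

lemma eLpNorm_le_mul_rpow {f : ℝ → ℂ} {b N : ℝ≥0∞} (hb : ∀ x, ‖f x‖ₑ ≤ b)
    (hN : ∫⁻ x, ‖f x‖ₑ ≤ N * b) {p : ℝ} (hp : 1 ≤ p) (hbt : b ≠ ⊤) :
    eLpNorm f (ENNReal.ofReal p) volume ≤ b * N ^ (1 / p) := by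
  have hp0 : 0 < p := by linarith
  rw [eLpNorm_eq_lintegral_rpow_enorm_toReal (by simpa using hp0) ENNReal.ofReal_ne_top,
    ENNReal.toReal_ofReal hp0.le]
  have h1 : ∀ x, ‖f x‖ₑ ^ p ≤ b ^ (p - 1) * ‖f x‖ₑ := fun x => by
    calc ‖f x‖ₑ ^ p = ‖f x‖ₑ ^ (p - 1) * ‖f x‖ₑ := by
          conv_rhs => rw [← ENNReal.rpow_one ‖f x‖ₑ, ← ENNReal.rpow_mul, one_mul,
            ← ENNReal.rpow_add_of_nonneg _ _ (by linarith) zero_le_one, sub_add_cancel]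
      _ ≤ _ := by gcongr; exact hb x
  have h2 : ∫⁻ x, ‖f x‖ₑ ^ p ≤ b ^ p * N := by
    calc ∫⁻ x, ‖f x‖ₑ ^ p ≤ ∫⁻ x, b ^ (p - 1) * ‖f x‖ₑ := lintegral_mono h1
      _ = b ^ (p - 1) * ∫⁻ x, ‖f x‖ₑ :=
        lintegral_const_mul' _ _ (ENNReal.rpow_ne_top_of_nonneg (by linarith) hbt)
      _ ≤ b ^ (p - 1) * (N * b) := by gcongr
      _ = b ^ (p - 1) * b ^ (1 : ℝ) * N := by rw [ENNReal.rpow_one]; ring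
      _ = b ^ p * N := by
        rw [← ENNReal.rpow_add_of_nonneg _ _ (by linarith) zero_le_one, sub_add_cancel]
  calc _ ≤ (b ^ p * N) ^ (1 / p) := by gcongr
    _ = b * N ^ (1 / p) := by
      rw [ENNReal.mul_rpow_of_nonneg _ _ (by positivity), ← ENNReal.rpow_mul,
        mul_one_div_cancel hp0.ne', ENNReal.rpow_one]

lemma lintegral_packetFun_le (M : ℝ) (N : ℕ) {s : ℝ} (hs : s * s = 1) (l : ℝ) :
    ∫⁻ x, ‖packetFun M N s l x‖ₑ ≤ N * ENNReal.ofReal (∫ x, ‖profile x‖) := by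
  obtain ⟨g, -, hg⟩ := norm_packetFun_le M N hs l
  calc ∫⁻ x, ‖packetFun M N s l x‖ₑ
      ≤ ∫⁻ x, ∑ k ∈ Finset.range N, ‖profile (x - M * g k)‖ₑ := by
        refine lintegral_mono fun x => ?_
        rw [← ofReal_norm]
        refine (ENNReal.ofReal_le_ofReal (hg x)).trans (le_of_eq ?_)
        rw [ENNReal.ofReal_sum_of_nonneg fun _ _ => norm_nonneg _]
        simp only [ofReal_norm]
    _ = ∑ k ∈ Finset.range N, ∫⁻ x, ‖profile (x - M * g k)‖ₑ :=
        lintegral_finsetSum _ fun k _ => by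
          have := continuous_profile
          exact (by fun_prop : Continuous fun x => profile (x - M * g k)).measurable.enorm
    _ = ∑ k ∈ Finset.range N, ∫⁻ x, ‖profile x‖ₑ :=
        Finset.sum_congr rfl fun k _ => lintegral_sub_right_eq_self (fun x => ‖profile x‖ₑ) _
    _ = N * ENNReal.ofReal (∫ x, ‖profile x‖) := by
        rw [ofReal_integral_norm_eq_lintegral_enorm integrable_profile]
        simp

lemma volume_biUnion_Icc {M δ : ℝ} (hM : 1 ≤ M) (hδ : δ < 1 / 2) (D : ℕ) :
    volume (⋃ i ∈ Finset.range D, Set.Icc (M * i - δ) (M * i + δ)) =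
      D * ENNReal.ofReal (2 * δ) := by
  rw [measure_biUnion_finset ?_ fun _ _ => measurableSet_Icc]
  · have : ∀ i : ℕ, M * i + δ - (M * i - δ) = 2 * δ := fun i => by ring
    simp [this]
  · have key : ∀ i j : ℕ, i < j →
        Disjoint (Set.Icc (M * i - δ) (M * i + δ)) (Set.Icc (M * j - δ) (M * j + δ)) := by
      intro i j hij
      rw [Set.disjoint_left]
      rintro x ⟨-, h1⟩ ⟨h2, -⟩
      have h3 : (i : ℝ) + 1 ≤ j := by exact_mod_cast hij
      nlinarith
    intro i _ j _ hij
    rcases lt_or_gt_of_ne hij with h | h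
    · exact key i j h
    · exact (key j i h).symm

lemma le_eLpNorm_of_le_norm {F : ℝ → ℂ} {M δ κ : ℝ} (hM : 1 ≤ M) (hδ : δ < 1 / 2) {D : ℕ}
    (hF : ∀ (i : ℕ) (y : ℝ), i < D → |y| ≤ δ → κ ≤ ‖F (y + M * i)‖) {P : ℝ} (hP : 0 < P) :
    ENNReal.ofReal κ * (D * ENNReal.ofReal (2 * δ)) ^ P ≤
      eLpNorm F (ENNReal.ofReal (1 / P)) volume := by
  have hP' : 0 < 1 / P := by positivity
  set G := ⋃ i ∈ Finset.range D, Set.Icc (M * i - δ) (M * i + δ) with hG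
  have hGm : MeasurableSet G := Finset.measurableSet_biUnion _ fun _ _ => measurableSet_Icc
  have h := eLpNorm_indicator_const (μ := volume) (c := max κ 0) hGm
    (p := ENNReal.ofReal (1 / P)) (by simpa using hP) ENNReal.ofReal_ne_top
  rw [ENNReal.toReal_ofReal hP'.le, one_div_one_div, volume_biUnion_Icc hM hδ,
    Real.enorm_eq_ofReal (le_max_right _ _)] at h
  calc _ ≤ ENNReal.ofReal (max κ 0) * (D * ENNReal.ofReal (2 * δ)) ^ P := by
        gcongr; exact le_max_left _ _
    _ ≤ _ := by
      rw [← h]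
      refine eLpNorm_mono fun x => ?_
      by_cases hx : x ∈ G
      · rw [Set.indicator_of_mem hx, Real.norm_of_nonneg (le_max_right _ _)]
        refine max_le ?_ (norm_nonneg _)
        simp only [hG, Set.mem_iUnion, Finset.mem_range, Set.mem_Icc] at hx
        obtain ⟨i, hi, h1, h2⟩ := hx
        simpa using hF i (x - M * i) hi (abs_le.2 ⟨by linarith, by linarith⟩)
      · rw [Set.indicator_of_notMem hx, norm_zero]
        exact norm_nonneg _

/-- `C_n^ε` with the sign pattern `(1,…,1,-1)` (the `-1` at the last
position, i.e. `0`-based index `n-1`) is unbounded when `1/p_{n-1} + 1/p_n < 1`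
(here the last two exponents are the `0`-based indices `n-2` and `n-1`). -/
theorem stmt9 (n : ℕ) (hn : 3 ≤ n) (p : Fin n → ℝ) (hp : ∀ i, 1 ≤ p i)
    (hlast : 1 / p ⟨n - 2, by omega⟩ + 1 / p ⟨n - 1, by omega⟩ < 1)
    (C : ℝ) (hC : 0 < C) :
    ∃ f : Fin n → SchwartzMap ℝ ℂ,
      (∀ i, HasCompactSupport (𝓕 ⇑(f i))) ∧
      ENNReal.ofReal C * ∏ i, eLpNorm ⇑(f i) (ENNReal.ofReal (p i)) volume <
        eLpNorm
          (Cop (fun i : Fin n => if (i : ℕ) = n - 1 then (-1 : ℝ) else 1)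
            (fun i => ⇑(f i)))
          (ENNReal.ofReal (1 / ∑ i, 1 / p i)) volume := by
  obtain ⟨m, rfl⟩ : ∃ m, n = m + 3 := ⟨n - 3, by omega⟩
  obtain ⟨M, B, δ, c, K, hM, hB, hδ0, hδ, hc, hsum, hlow⟩ := exists_packet_constants
  set P := ∑ i, 1 / p i with hPdef
  have hP : 0 < P := Finset.sum_pos
    (fun i _ => one_div_pos.2 (by linarith [hp i])) Finset.univ_nonempty
  set b := max B (∫ x, ‖profile x‖) with hb
  have hb0 : 0 < b := lt_max_of_lt_left hB
  obtain ⟨D, hD, hD1⟩ : ∃ D : ℕ, C * (b ^ (m + 3) * 2 ^ P) <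
      (1 / 2) ^ m * (c * ∑ r ∈ Finset.range D, 1 / ((r : ℝ) + 1) - K) * (2 * δ) ^ P ∧ 1 ≤ D := by
    have h := Real.tendsto_sum_range_one_div_nat_succ_atTop.const_mul_atTop hc
    have h := (((Filter.tendsto_atTop_add_const_right _ (-K) h).const_mul_atTop
      (by positivity : (0 : ℝ) < (1 / 2) ^ m)).atTop_mul_const
      (by positivity : (0 : ℝ) < (2 * δ) ^ P))
    exact ((h.eventually_gt_atTop _).and (Filter.eventually_ge_atTop 1)).exists
  have hD0 : (0 : ℝ) < D := by exact_mod_cast hD1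
  refine ⟨fun i => packetFun M (2 * D) (lastSign m i) (offset m (2 * D) i), fun i => ?_, ?_⟩
  · rw [fourier_packetFun]
    exact hasCompactSupport_packet _ _ _ _ _
  refine lt_of_lt_of_le ?_ (le_eLpNorm_of_le_norm hM hδ
    (fun i y hi hy => hlow m D i y hi hy) hP)
  have hupp : ∀ i : Fin (m + 3),
      eLpNorm ⇑(packetFun M (2 * D) (lastSign m i) (offset m (2 * D) i))
        (ENNReal.ofReal (p i)) volume ≤ ENNReal.ofReal (b * (2 * D) ^ (1 / p i)) := by
    intro i
    have hs := lastSign_mul_self m i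
    obtain ⟨g, hg, hle⟩ := norm_packetFun_le M (2 * D) hs (offset m (2 * D) i)
    rw [ENNReal.ofReal_mul hb0.le, ← ENNReal.ofReal_rpow_of_pos (by positivity)]
    refine eLpNorm_le_mul_rpow (fun x => ?_) ?_ (hp i) ENNReal.ofReal_ne_top
    · rw [← ofReal_norm]
      exact ENNReal.ofReal_le_ofReal
        ((hle x).trans ((hsum g hg _ _).trans (le_max_left _ _)))
    · refine (lintegral_packetFun_le M (2 * D) hs _).trans ?_
      rw [← ENNReal.ofReal_natCast]
      push_cast
      gcongr
      exact le_max_right _ _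
  have hprod : ∏ i, b * (2 * (D : ℝ)) ^ (1 / p i) = b ^ (m + 3) * (2 * D) ^ P := by
    rw [Finset.prod_mul_distrib, ← Real.rpow_sum_of_pos (by positivity), Finset.prod_const,
      Finset.card_univ, Fintype.card_fin]
  calc _ ≤ ENNReal.ofReal C *
        ∏ i : Fin (m + 3), ENNReal.ofReal (b * (2 * (D : ℝ)) ^ (1 / p i)) := by
        gcongr with i; exact hupp i
    _ = ENNReal.ofReal (C * (b ^ (m + 3) * 2 ^ P) * D ^ P) := by
      rw [← ENNReal.ofReal_prod_of_nonneg fun i _ => by positivity, hprod,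
        ← ENNReal.ofReal_mul hC.le, Real.mul_rpow zero_le_two hD0.le]
      ring_nf
    _ < ENNReal.ofReal ((1 / 2) ^ m * (c * ∑ r ∈ Finset.range D, 1 / ((r : ℝ) + 1) - K) *
          (2 * δ) ^ P * D ^ P) := by
      have h1 : 0 < (D : ℝ) ^ P := by positivity
      have h2 : 0 < C * (b ^ (m + 3) * 2 ^ P) := by positivity
      exact (ENNReal.ofReal_lt_ofReal_iff (mul_pos (h2.trans hD) h1)).2
        (mul_lt_mul_of_pos_right hD h1)
    _ = _ := by
      rw [mul_assoc, ENNReal.ofReal_mul' (by positivity), mul_comm (_ ^ P),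
        ← Real.mul_rpow hD0.le (by positivity), ← ENNReal.ofReal_rpow_of_pos (by positivity),
        ENNReal.ofReal_mul hD0.le, ENNReal.ofReal_natCast]
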